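/- Let C be a preadditive category with binary biproducts in which every morphism has a cokernel. Define L : Arrow C ⥤ C × C × C by L(f : a ⟶ b) = (a, b, coker f), and define R : C × C × C ⥤ Arrow C by letting R(x, y, z) be the object of Arrow C given by the morphism x ⊞ y ⟶ y ⊞ z whose component from the y-summand of the source to the y-summand of the target is the identity 𝟙 y and whose other components are zero. Then L is left adjoint to R. -/

import Mathlib

open CategoryTheory CategoryTheory.Limits

variable (C : Type*) [Category C] [Preadditive C] [HasBinaryBiproducts C] [HasCokernels C]

/-- The functor `L : Arrow C ⥤ C × C × C` sending `(f : a ⟶ b)` to `(a, b, coker f)`. -/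
noncomputable def L : Arrow C ⥤ C × C × C where
  obj f := (f.left, f.right, cokernel f.hom)
  map {f g} φ := (φ.left, φ.right, cokernel.map f.hom g.hom φ.left φ.right φ.w.symm)
  map_id f := by
    refine Prod.ext rfl (Prod.ext rfl ?_)
    apply coequalizer.hom_ext
    simp
  map_comp φ ψ := by
    refine Prod.ext rfl (Prod.ext rfl ?_)
    apply coequalizer.hom_ext
    simp

/-- The functor `R : C × C × C ⥤ Arrow C` sending `(x, y, z)` to the morphism
`x ⊞ y ⟶ y ⊞ z` whose component from the `y`-summand of the source to the `y`-summand of the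
target is the identity `𝟙 y`, and whose other components vanish. -/
noncomputable def R : C × C × C ⥤ Arrow C where
  obj p := Arrow.mk (biprod.desc (0 : p.1 ⟶ p.2.1 ⊞ p.2.2) (biprod.inl : p.2.1 ⟶ p.2.1 ⊞ p.2.2))
  map {p q} φ := Arrow.homMk (u := biprod.map φ.1 φ.2.1) (v := biprod.map φ.2.1 φ.2.2)
    (by apply biprod.hom_ext' <;> simp)
  map_id p := by
    apply Arrow.hom_ext <;> dsimp <;> apply biprod.hom_ext' <;> simp
  map_comp φ ψ := by
    apply Arrow.hom_ext <;> dsimp <;> apply biprod.hom_ext' <;> simp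

lemma desc_zero_inl_fst {D : Type*} [Category D] [Preadditive D] [HasBinaryBiproducts D]
    (x y z : D) :
    biprod.desc (0 : x ⟶ y ⊞ z) biprod.inl ≫ biprod.fst = biprod.snd := by
  apply biprod.hom_ext' <;> simp

lemma desc_zero_inl_snd {D : Type*} [Category D] [Preadditive D] [HasBinaryBiproducts D]
    (x y z : D) :
    biprod.desc (0 : x ⟶ y ⊞ z) biprod.inl ≫ biprod.snd = 0 := by
  apply biprod.hom_ext' <;> simp

lemma right_comp_fst {D : Type*} [Category D] [Preadditive D] [HasBinaryBiproducts D]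
    {f : Arrow D} {p : D × D × D} (ψ : f ⟶ (R D).obj p) :
    f.hom ≫ ψ.right ≫ (biprod.fst : p.2.1 ⊞ p.2.2 ⟶ p.2.1) =
      ψ.left ≫ (biprod.snd : p.1 ⊞ p.2.1 ⟶ p.2.1) := by
  have h := congrArg (· ≫ (biprod.fst : p.2.1 ⊞ p.2.2 ⟶ p.2.1)) ψ.w
  exact (Category.assoc _ _ _).symm.trans (h.symm.trans ((Category.assoc _ _ _).trans
    (congrArg (ψ.left ≫ ·) (desc_zero_inl_fst p.1 p.2.1 p.2.2))))

lemma right_comp_snd {D : Type*} [Category D] [Preadditive D] [HasBinaryBiproducts D]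
    {f : Arrow D} {p : D × D × D} (ψ : f ⟶ (R D).obj p) :
    f.hom ≫ ψ.right ≫ (biprod.snd : p.2.1 ⊞ p.2.2 ⟶ p.2.2) = 0 := by
  have h := congrArg (· ≫ (biprod.snd : p.2.1 ⊞ p.2.2 ⟶ p.2.2)) ψ.w
  exact (Category.assoc _ _ _).symm.trans (h.symm.trans ((Category.assoc _ _ _).trans
    ((congrArg (ψ.left ≫ ·) (desc_zero_inl_snd p.1 p.2.1 p.2.2)).trans comp_zero)))

lemma biprod_lift_map {D : Type*} [Category D] [Preadditive D] [HasBinaryBiproducts D]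
    {w x y x' y' : D} (a : w ⟶ x) (b : w ⟶ y) (g : x ⟶ x') (h : y ⟶ y') :
    biprod.lift a b ≫ biprod.map g h = biprod.lift (a ≫ g) (b ≫ h) := by
  apply biprod.hom_ext <;> simp

variable {C} in
/-- A triple of morphisms `a ⟶ x`, `b ⟶ y`, `coker f ⟶ z` amounts to a commutative square from
`f : a ⟶ b` to `x ⊞ y ⟶ y ⊞ z`. -/
noncomputable def homEquivLR (f : Arrow C) (p : C × C × C) :
    ((L C).obj f ⟶ p) ≃ (f ⟶ (R C).obj p) where
  toFun φ := Arrow.homMk (u := biprod.lift φ.1 (f.hom ≫ φ.2.1))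
    (v := biprod.lift φ.2.1 (cokernel.π f.hom ≫ φ.2.2))
    (by apply biprod.hom_ext <;> simp [L, R])
  invFun ψ := (ψ.left ≫ biprod.fst, ψ.right ≫ biprod.fst,
    cokernel.desc f.hom (ψ.right ≫ biprod.snd) (right_comp_snd ψ))
  left_inv φ := by
    refine Prod.ext (biprod.lift_fst _ _) (Prod.ext (biprod.lift_fst _ _) ?_)
    apply coequalizer.hom_ext
    exact (cokernel.π_desc _ _ _).trans (biprod.lift_snd _ _)
  right_inv ψ := by
    apply Arrow.hom_ext
    · apply biprod.hom_ext
      · exact biprod.lift_fst _ _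
      · exact (biprod.lift_snd _ _).trans (right_comp_fst ψ)
    · apply biprod.hom_ext
      · exact biprod.lift_fst _ _
      · exact (biprod.lift_snd _ _).trans (cokernel.π_desc _ _ _)

/-- `L : Arrow C ⥤ C × C × C`, `(f : a ⟶ b) ↦ (a, b, coker f)`, is left adjoint to the functor
`R : C × C × C ⥤ Arrow C`, `(x, y, z) ↦ (x ⊞ y ⟶ y ⊞ z)` (the morphism whose only nonzero
component is `𝟙 y`). -/
theorem L_leftAdjoint_R : Nonempty (L C ⊣ R C) := by
  refine ⟨Adjunction.mkOfHomEquiv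
    { homEquiv := homEquivLR
      homEquiv_naturality_left_symm := ?_
      homEquiv_naturality_right := ?_ }⟩
  · intro f g p φ ψ
    refine Prod.ext (Category.assoc _ _ _) (Prod.ext (Category.assoc _ _ _) ?_)
    apply coequalizer.hom_ext
    change cokernel.π f.hom ≫ cokernel.desc f.hom ((φ.right ≫ ψ.right) ≫ biprod.snd) _ =
      cokernel.π f.hom ≫ cokernel.map f.hom g.hom φ.left φ.right φ.w.symm ≫
        cokernel.desc g.hom (ψ.right ≫ biprod.snd) (right_comp_snd ψ)
    refine (cokernel.π_desc _ _ _).trans ((Category.assoc _ _ _).trans ?_)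
    simp
  · intro f p q φ ψ
    apply Arrow.hom_ext
    · refine Eq.trans ?_ (biprod_lift_map φ.1 (f.hom ≫ φ.2.1) ψ.1 ψ.2.1).symm
      exact congrArg (biprod.lift (φ.1 ≫ ψ.1)) (Category.assoc _ _ _).symm
    · refine Eq.trans ?_ (biprod_lift_map φ.2.1 (cokernel.π f.hom ≫ φ.2.2) ψ.2.1 ψ.2.2).symm
      exact congrArg (biprod.lift (φ.2.1 ≫ ψ.2.1)) (Category.assoc _ _ _).symm
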